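/- Let n ∈ ℕ, let U ⊆ ℝ³ be open, let f : ℝ³ → ℂ be n-times continuously differentiable on U, let r ∈ U, and let (x', y', z') ∈ ℝ³. Then the n-th iterate of the directional derivative operator x'∂/∂x + y'∂/∂y + z'∂/∂z applied to f at r satisfies ((x'∂ₓ + y'∂_y + z'∂_z)ⁿ f)(r) = Σ_{m=0}^{n} Σ_{s=0}^{m} (n! / (2^m (n−m)! s! (m−s)!)) · α̃ₙₘˢ(x', y', z') · (𝒟ₙₘˢ f)(r). -/

import Mathlib

open Complex Finset

noncomputable section

/-- Euclidean 3-space. -/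
abbrev E3 := EuclideanSpace ℝ (Fin 3)

/-- Partial derivative of a complex-valued function along the `i`-th coordinate. -/
noncomputable def pd (i : Fin 3) (f : E3 → ℂ) : E3 → ℂ :=
  fun r => fderiv ℝ f r (EuclideanSpace.single i 1)

/-- The operator ∂/∂x + i ∂/∂y. -/
noncomputable def Dplus (f : E3 → ℂ) : E3 → ℂ := fun r => pd 0 f r + I * pd 1 f r

/-- The operator ∂/∂x − i ∂/∂y. -/
noncomputable def Dminus (f : E3 → ℂ) : E3 → ℂ := fun r => pd 0 f r - I * pd 1 f r

/-- The mixed derivative 𝒟ₙₘˢ = (∂x − i∂y)^s (∂x + i∂y)^{m−s} (∂z)^{n−m}. -/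
noncomputable def Dop (n m s : ℕ) (f : E3 → ℂ) : E3 → ℂ :=
  Dminus^[s] (Dplus^[m - s] ((pd 2)^[n - m] f))

/-- The directional derivative operator x'∂/∂x + y'∂/∂y + z'∂/∂z. -/
noncomputable def dirOp (x' y' z' : ℝ) (f : E3 → ℂ) : E3 → ℂ :=
  fun r => (x' : ℂ) * pd 0 f r + (y' : ℂ) * pd 1 f r + (z' : ℂ) * pd 2 f r

/-- The symmetric Taylor monomial α̃ₙₘˢ(x',y',z') = (x'+iy')^s (x'−iy')^{m−s} (z')^{n−m}. -/
noncomputable def tAlpha (n m s : ℕ) (x' y' z' : ℝ) : ℂ :=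
  ((x' : ℂ) + I * (y' : ℂ)) ^ s * ((x' : ℂ) - I * (y' : ℂ)) ^ (m - s) *
    ((z' : ℂ)) ^ (n - m)

/-- The first-order constant-coefficient operator `∑ i, c i ∂ᵢ`. -/
def linOp (c : Fin 3 → ℂ) (f : E3 → ℂ) : E3 → ℂ := fun r => ∑ i, c i * pd i f r

/-- The mixed partial derivative with multi-index `a`. -/
def monOp (f : E3 → ℂ) (a : Fin 3 →₀ ℕ) : E3 → ℂ :=
  (pd 0)^[a 0] ((pd 1)^[a 1] ((pd 2)^[a 2] f))

/-- The constant-coefficient differential operator with symbol `P`, applied to `f`. -/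
def polyOp (f : E3 → ℂ) : MvPolynomial (Fin 3) ℂ →ₗ[ℂ] (E3 → ℂ) :=
  (MvPolynomial.basisMonomials (Fin 3) ℂ).constr ℂ (monOp f)

/-- The symbol of `linOp c`. -/
def linSymbol (c : Fin 3 → ℂ) : MvPolynomial (Fin 3) ℂ :=
  ∑ i, MvPolynomial.C (c i) * MvPolynomial.X i

lemma polyOp_monomial (f : E3 → ℂ) (a : Fin 3 →₀ ℕ) (c : ℂ) :
    polyOp f (MvPolynomial.monomial a c) = c • monOp f a := by
  have h : MvPolynomial.monomial a c = c • MvPolynomial.basisMonomials (Fin 3) ℂ a := by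
    simp [MvPolynomial.smul_monomial]
  rw [h, map_smul, polyOp, Module.Basis.constr_basis]

lemma polyOp_one (f : E3 → ℂ) : polyOp f 1 = f := by
  rw [← MvPolynomial.C_1, ← MvPolynomial.monomial_zero', polyOp_monomial]
  simp [monOp]

section
variable {U : Set E3} {f g : E3 → ℂ}

lemma contDiffOn_pd (hU : IsOpen U) {k : ℕ} (hf : ContDiffOn ℝ (k + 1 : ℕ) f U) (i : Fin 3) :
    ContDiffOn ℝ k (pd i f) U :=
  (hf.fderiv_of_isOpen hU (by norm_cast)).clm_apply contDiffOn_const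

lemma contDiffOn_pd_iterate (hU : IsOpen U) {k : ℕ} (i : Fin 3) (j : ℕ)
    (hf : ContDiffOn ℝ (k + j : ℕ) f U) : ContDiffOn ℝ k ((pd i)^[j] f) U := by
  induction j generalizing f with
  | zero => simpa using hf
  | succ j ih => exact ih (contDiffOn_pd hU hf i)

lemma eqOn_pd (hU : IsOpen U) (h : Set.EqOn f g U) (i : Fin 3) :
    Set.EqOn (pd i f) (pd i g) U := fun r hr => by
  have h' : f =ᶠ[nhds r] g := h.eventuallyEq_of_mem (hU.mem_nhds hr)
  simp only [pd, h'.fderiv_eq]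

lemma eqOn_pd_iterate (hU : IsOpen U) (h : Set.EqOn f g U) (i : Fin 3) (j : ℕ) :
    Set.EqOn ((pd i)^[j] f) ((pd i)^[j] g) U := by
  induction j generalizing f g with
  | zero => exact h
  | succ j ih => exact ih (eqOn_pd hU h i)

lemma eqOn_linOp (hU : IsOpen U) (h : Set.EqOn f g U) (c : Fin 3 → ℂ) :
    Set.EqOn (linOp c f) (linOp c g) U := fun r hr => by
  simp only [linOp, eqOn_pd hU h _ hr]

lemma eqOn_linOp_iterate (hU : IsOpen U) (h : Set.EqOn f g U) (c : Fin 3 → ℂ) (j : ℕ) :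
    Set.EqOn ((linOp c)^[j] f) ((linOp c)^[j] g) U := by
  induction j generalizing f g with
  | zero => exact h
  | succ j ih => exact ih (eqOn_linOp hU h c)

lemma pd_comm (hU : IsOpen U) (hf : ContDiffOn ℝ 2 f U) (i j : Fin 3) :
    Set.EqOn (pd i (pd j f)) (pd j (pd i f)) U := fun r hr => by
  have hc : ContDiffAt ℝ 2 f r := hf.contDiffAt (hU.mem_nhds hr)
  have hd : DifferentiableAt ℝ (fderiv ℝ f) r :=
    (hc.fderiv_right (m := 1) (by norm_num)).differentiableAt (by norm_num)
  have key (i j : Fin 3) : pd i (pd j f) r =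
      fderiv ℝ (fderiv ℝ f) r (EuclideanSpace.single i 1) (EuclideanSpace.single j 1) := by
    unfold pd
    rw [fderiv_clm_apply hd (differentiableAt_const _)]
    simp
  rw [key, key]
  exact hc.isSymmSndFDerivAt (by simp) _ _

lemma pd_comm_iterate (hU : IsOpen U) (i j : Fin 3) (k : ℕ)
    (hf : ContDiffOn ℝ (k + 1 : ℕ) f U) :
    Set.EqOn (pd i ((pd j)^[k] f)) ((pd j)^[k] (pd i f)) U := by
  induction k generalizing f with
  | zero => exact fun _ _ => rfl
  | succ k ih =>
    have h2 : ContDiffOn ℝ 2 f U := hf.of_le (by norm_cast; omega)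
    exact (ih (contDiffOn_pd hU hf j)).trans (eqOn_pd_iterate hU (pd_comm hU h2 i j) j k)

lemma contDiffOn_monOp (hU : IsOpen U) {k : ℕ} (a : Fin 3 →₀ ℕ)
    (hf : ContDiffOn ℝ (k + a.degree : ℕ) f U) : ContDiffOn ℝ k (monOp f a) U := by
  have h : k + a.degree = k + a 0 + a 1 + a 2 := by
    rw [Finsupp.degree_eq_sum, Fin.sum_univ_three]; ring
  rw [h] at hf
  exact contDiffOn_pd_iterate hU _ _ (contDiffOn_pd_iterate hU _ _ (contDiffOn_pd_iterate hU _ _ hf))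

lemma pd_monOp (hU : IsOpen U) (a : Fin 3 →₀ ℕ) (i : Fin 3)
    (hf : ContDiffOn ℝ (a.degree + 1 : ℕ) f U) :
    Set.EqOn (pd i (monOp f a)) (monOp f (a + Finsupp.single i 1)) U := by
  have h : a.degree + 1 = 1 + a 0 + a 1 + a 2 := by
    rw [Finsupp.degree_eq_sum, Fin.sum_univ_three]; ring
  rw [h] at hf
  have h2 := contDiffOn_pd_iterate hU 2 (a 2) hf
  have h1 := contDiffOn_pd_iterate hU 1 (a 1) h2
  have e0 := pd_comm_iterate hU i 0 (a 0) (by rwa [add_comm] at h1)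
  have e1 := pd_comm_iterate hU i 1 (a 1) (h2.of_le (by norm_cast; omega))
  have e2 := pd_comm_iterate hU i 2 (a 2) (hf.of_le (by norm_cast; omega))
  fin_cases i
  · simp [monOp, Function.iterate_succ_apply']
    exact fun _ _ => rfl
  · refine e0.trans ?_
    simp [monOp, Function.iterate_succ_apply']
    exact fun _ _ => rfl
  · refine e0.trans ((eqOn_pd_iterate hU e1 0 _).trans ?_)
    simp [monOp, Function.iterate_succ_apply']
    exact fun _ _ => rfl

lemma pd_polyOp (hU : IsOpen U) (P : MvPolynomial (Fin 3) ℂ) (i : Fin 3)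
    (hf : ContDiffOn ℝ (P.totalDegree + 1 : ℕ) f U) :
    Set.EqOn (pd i (polyOp f P)) (polyOp f (MvPolynomial.X i * P)) U := fun r hr => by
  have hdeg (a) (ha : a ∈ P.support) : ContDiffOn ℝ (a.degree + 1 : ℕ) f U :=
    hf.of_le (by exact_mod_cast Nat.succ_le_succ (MvPolynomial.le_totalDegree ha))
  have hd (a) (ha : a ∈ P.support) : DifferentiableAt ℝ (monOp f a) r :=
    ((contDiffOn_monOp hU (k := 1) a (by rw [add_comm]; exact hdeg a ha)).contDiffAt
      (hU.mem_nhds hr)).differentiableAt (by norm_num)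
  have hP : polyOp f P = fun r => ∑ a ∈ P.support, P.coeff a * monOp f a r := by
    conv_lhs => rw [P.as_sum, map_sum]
    ext r
    simp [polyOp_monomial]
  have hXP : polyOp f (MvPolynomial.X i * P) r =
      ∑ a ∈ P.support, P.coeff a * monOp f (a + Finsupp.single i 1) r := by
    conv_lhs => rw [P.as_sum, Finset.mul_sum, map_sum]
    simp [polyOp_monomial, add_comm (Finsupp.single i 1), MvPolynomial.X,
      MvPolynomial.monomial_mul]
  rw [hXP, hP, pd, fderiv_fun_sum fun a ha => (hd a ha).const_mul _, _root_.sum_apply]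
  refine Finset.sum_congr rfl fun a ha => ?_
  rw [fderiv_const_mul (hd a ha), ← pd_monOp hU a i (hdeg a ha) hr]
  rfl

lemma linOp_polyOp (hU : IsOpen U) (P : MvPolynomial (Fin 3) ℂ) (c : Fin 3 → ℂ)
    (hf : ContDiffOn ℝ (P.totalDegree + 1 : ℕ) f U) :
    Set.EqOn (linOp c (polyOp f P)) (polyOp f (linSymbol c * P)) U := fun r hr => by
  simp only [linOp, linSymbol, Finset.sum_mul, map_sum, MvPolynomial.C_mul', map_smul,
    Finset.sum_apply, Pi.smul_apply, smul_eq_mul, smul_mul_assoc, pd_polyOp hU P _ hf hr]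

lemma totalDegree_linSymbol_le (c : Fin 3 → ℂ) : (linSymbol c).totalDegree ≤ 1 :=
  MvPolynomial.totalDegree_finsetSum_le fun i _ =>
    (MvPolynomial.totalDegree_mul _ _).trans (by simp)

lemma linOp_iterate_polyOp (hU : IsOpen U) (c : Fin 3 → ℂ) (k : ℕ) (P : MvPolynomial (Fin 3) ℂ)
    {n : ℕ} (hn : P.totalDegree + k ≤ n) (hf : ContDiffOn ℝ n f U) :
    Set.EqOn ((linOp c)^[k] (polyOp f P)) (polyOp f (linSymbol c ^ k * P)) U := by
  induction k generalizing P with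
  | zero => simp [Set.EqOn]
  | succ k ih =>
    have h := linOp_polyOp hU P c (hf.of_le (by norm_cast; omega))
    refine (eqOn_linOp_iterate hU h c k).trans ?_
    rw [pow_succ, mul_assoc]
    refine ih _ ?_
    have := MvPolynomial.totalDegree_mul (linSymbol c) P
    have := totalDegree_linSymbol_le c
    omega

end

lemma pd_two_eq_linOp : pd 2 = linOp ![0, 0, 1] := by
  ext f r; simp [linOp, Fin.sum_univ_three]

lemma Dplus_eq_linOp : Dplus = linOp ![1, I, 0] := by
  ext f r; simp [linOp, Dplus, Fin.sum_univ_three]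

lemma Dminus_eq_linOp : Dminus = linOp ![1, -I, 0] := by
  ext f r; simp [linOp, Dminus, Fin.sum_univ_three, sub_eq_add_neg]

lemma dirOp_eq_linOp (x y z : ℝ) : dirOp x y z = linOp ![(x : ℂ), y, z] := by
  ext f r; simp [linOp, dirOp, Fin.sum_univ_three]

lemma totalDegree_linSymbol_pow_le (c : Fin 3 → ℂ) (k : ℕ) :
    (linSymbol c ^ k).totalDegree ≤ k :=
  (MvPolynomial.totalDegree_pow _ _).trans
    ((Nat.mul_le_mul_left k (totalDegree_linSymbol_le c)).trans_eq (mul_one k))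

lemma Dop_eq_polyOp {U : Set E3} (hU : IsOpen U) {f : E3 → ℂ} {n m s : ℕ} (hm : m ≤ n)
    (hs : s ≤ m) (hf : ContDiffOn ℝ n f U) :
    Set.EqOn (Dop n m s f) (polyOp f (linSymbol ![1, -I, 0] ^ s *
      (linSymbol ![1, I, 0] ^ (m - s) * linSymbol ![0, 0, 1] ^ (n - m)))) U := by
  have hz := totalDegree_linSymbol_pow_le ![0, 0, 1] (n - m)
  have hp := totalDegree_linSymbol_pow_le ![1, I, 0] (m - s)
  have hpz := MvPolynomial.totalDegree_mul (linSymbol ![1, I, 0] ^ (m - s))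
    (linSymbol ![0, 0, 1] ^ (n - m))
  have e2 := linOp_iterate_polyOp hU ![0, 0, 1] (n - m) 1 (by simp) hf
  rw [polyOp_one, mul_one] at e2
  have e1 := linOp_iterate_polyOp hU ![1, I, 0] (m - s) (linSymbol ![0, 0, 1] ^ (n - m))
    (n := n) (by omega) hf
  have e0 := linOp_iterate_polyOp hU ![1, -I, 0] s
    (linSymbol ![1, I, 0] ^ (m - s) * linSymbol ![0, 0, 1] ^ (n - m)) (n := n) (by omega) hf
  rw [Dop, Dminus_eq_linOp, Dplus_eq_linOp, pd_two_eq_linOp]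
  exact (eqOn_linOp_iterate hU ((eqOn_linOp_iterate hU e2 _ _).trans e1) _ _).trans e0

/-- The trinomial expansion of `(a p / 2 + b q / 2 + c w) ^ n` in a commutative algebra. -/
lemma half_add_half_add_pow {A : Type*} [CommRing A] [Algebra ℂ A] (a b c : ℂ) (p q w : A)
    (n : ℕ) :
    ((a / 2) • p + (b / 2) • q + c • w) ^ n =
      ∑ m ∈ Finset.range (n + 1), ∑ s ∈ Finset.range (m + 1),
        (((n.factorial : ℂ) /
            ((2 : ℂ) ^ m * ((n - m).factorial : ℂ) * (s.factorial : ℂ) *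
              ((m - s).factorial : ℂ))) * (a ^ s * b ^ (m - s) * c ^ (n - m))) •
          (p ^ s * (q ^ (m - s) * w ^ (n - m))) := by
  rw [add_pow]
  refine Finset.sum_congr rfl fun m hm => ?_
  rw [add_pow, Finset.sum_mul, Finset.sum_mul]
  refine Finset.sum_congr rfl fun s hs => ?_
  have hm' : m ≤ n := Nat.lt_succ_iff.mp (Finset.mem_range.mp hm)
  have hs' : s ≤ m := Nat.lt_succ_iff.mp (Finset.mem_range.mp hs)
  have hcoef : (n.factorial : ℂ) /
      ((2 : ℂ) ^ m * ((n - m).factorial : ℂ) * (s.factorial : ℂ) * ((m - s).factorial : ℂ)) =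
      (n.choose m : ℂ) * (m.choose s : ℂ) * (1 / 2) ^ s * (1 / 2) ^ (m - s) := by
    rw [mul_assoc _ ((1 / 2 : ℂ) ^ s), ← pow_add, Nat.add_sub_cancel' hs',
      Nat.cast_choose ℂ hm', Nat.cast_choose ℂ hs']
    have := Nat.cast_ne_zero (R := ℂ).mpr m.factorial_ne_zero
    have := Nat.cast_ne_zero (R := ℂ).mpr s.factorial_ne_zero
    have := Nat.cast_ne_zero (R := ℂ).mpr (n - m).factorial_ne_zero
    have := Nat.cast_ne_zero (R := ℂ).mpr (m - s).factorial_ne_zero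
    rw [div_pow, one_pow]
    field_simp
  rw [hcoef]
  simp only [Algebra.smul_def, map_mul, map_pow, map_natCast, div_eq_mul_inv, mul_pow, one_mul]
  ring

lemma linSymbol_eq (x y z : ℂ) :
    linSymbol ![x, y, z] = ((x + I * y) / 2) • linSymbol ![1, -I, 0] +
      ((x - I * y) / 2) • linSymbol ![1, I, 0] + z • linSymbol ![0, 0, 1] := by
  have hlin (c : ℂ) (u v w : Fin 3 → ℂ) (d e : ℂ) :
      c • linSymbol u + d • linSymbol v + e • linSymbol w =
        linSymbol (c • u + d • v + e • w) := by
    simp only [linSymbol, Finset.smul_sum, ← Finset.sum_add_distrib, MvPolynomial.C_mul',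
      smul_smul, ← add_smul, Pi.add_apply, Pi.smul_apply, smul_eq_mul]
  rw [hlin]
  congr 1
  ext i
  fin_cases i
  · simp; ring
  · simp; linear_combination y * I_mul_I
  · simp

/-- the n-th iterate of the directional derivative operator
x'∂ₓ + y'∂_y + z'∂_z applied to an n-times continuously differentiable function f,
evaluated at a point r of an open set U, expands into the symmetric mixed derivatives
𝒟ₙₘˢ f with the multinomial-type coefficients n!/(2^m (n−m)! s! (m−s)!) α̃ₙₘˢ. -/
theorem statement2 (n : ℕ) (U : Set E3) (hU : IsOpen U) (f : E3 → ℂ)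
    (hf : ContDiffOn ℝ n f U) (r : E3) (hr : r ∈ U) (x' y' z' : ℝ) :
    (dirOp x' y' z')^[n] f r =
      ∑ m ∈ Finset.range (n + 1), ∑ s ∈ Finset.range (m + 1),
        ((n.factorial : ℂ) /
            ((2 : ℂ) ^ m * ((n - m).factorial : ℂ) * (s.factorial : ℂ) *
              ((m - s).factorial : ℂ))) *
          tAlpha n m s x' y' z' * Dop n m s f r := by
  have h := linOp_iterate_polyOp hU ![(x' : ℂ), y', z'] n 1 (by simp) hf hr
  rw [polyOp_one, mul_one, linSymbol_eq, half_add_half_add_pow] at h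
  rw [dirOp_eq_linOp, h, map_sum, Finset.sum_apply]
  refine Finset.sum_congr rfl fun m hm => ?_
  rw [map_sum, Finset.sum_apply]
  refine Finset.sum_congr rfl fun s hs => ?_
  rw [Dop_eq_polyOp hU (Nat.lt_succ_iff.mp (Finset.mem_range.mp hm))
    (Nat.lt_succ_iff.mp (Finset.mem_range.mp hs)) hf hr, map_smul]
  rfl

end
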